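/- arXiv:2204.04255 — 3 statements merged into one kernel-verified Lean document; each statement's English description precedes it below -/
import Mathlib

section
/- Let n ≥ 1 and let A be an n × n matrix over a commutative ring. For k ≥ 0 and valid indices, let A_{ij}^{(k)} denote the k × k submatrix of A formed by rows i through i+k−1 and columns j through j+k−1, with the convention det(A_{ij}^{(0)}) = 1. Then for every k ≥ 1 and all indices i, j with 1 ≤ i, j ≤ n − k, one has det(A_{ij}^{(k+1)}) · det(A_{i+1,j+1}^{(k−1)}) = det(A_{ij}^{(k)}) · det(A_{i+1,j+1}^{(k)}) − det(A_{i,j+1}^{(k)}) · det(A_{i+1,j}^{(k)}) (the Desnanot–Jacobi identity). -/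
namespace Paper

/-- The `(a,b)` entry (0-indexed) of an `n × n` matrix, extended by junk value `0`
outside the index range. -/
def entry {R : Type*} [CommRing R] {n : ℕ} (A : Matrix (Fin n) (Fin n) R) (a b : ℕ) : R :=
  if h : a < n ∧ b < n then A ⟨a, h.1⟩ ⟨b, h.2⟩ else 0

/-- `det(A_{ij}^{(k)})`: the determinant of the `k × k` contiguous submatrix of `A` whose
rows are `i, …, i+k-1` and columns `j, …, j+k-1` (1-based indices); for `k = 0` this is `1`. -/
def subdet {R : Type*} [CommRing R] {n : ℕ} (A : Matrix (Fin n) (Fin n) R)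
    (i j k : ℕ) : R :=
  Matrix.det (Matrix.of fun a b : Fin k => entry A (i - 1 + a) (j - 1 + b))

section

open Matrix

/-- Jacobi's complementary minor formula, multiplied through by `det N`. -/
theorem det_mul_det_adjugate_toBlocks₁₁ {R p q : Type*} [CommRing R] [Fintype p] [Fintype q]
    [DecidableEq p] [DecidableEq q] (N : Matrix (p ⊕ q) (p ⊕ q) R) :
    N.det * N.adjugate.toBlocks₁₁.det = N.det ^ Fintype.card p * N.toBlocks₂₂.det := by
  have h : fromBlocks (N.det • (1 : Matrix p p R)) 0 0 (N.det • (1 : Matrix q q R)) =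
      fromBlocks N.toBlocks₁₁ N.toBlocks₁₂ N.toBlocks₂₁ N.toBlocks₂₂ *
      fromBlocks N.adjugate.toBlocks₁₁ N.adjugate.toBlocks₁₂
        N.adjugate.toBlocks₂₁ N.adjugate.toBlocks₂₂ := by
    rw [fromBlocks_toBlocks, fromBlocks_toBlocks, mul_adjugate, ← fromBlocks_one,
      fromBlocks_smul, smul_zero, smul_zero]
  rw [fromBlocks_multiply, fromBlocks_inj] at h
  have h' : N * fromBlocks N.adjugate.toBlocks₁₁ 0 N.adjugate.toBlocks₂₁ 1 =
      fromBlocks (N.det • 1) N.toBlocks₁₂ 0 N.toBlocks₂₂ := by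
    conv_lhs => rw [← fromBlocks_toBlocks N]
    rw [fromBlocks_multiply, fromBlocks_toBlocks, ← h.1, ← h.2.2.1]
    simp
  simpa using congrArg det h'

/-- Jacobi's complementary minor formula. -/
theorem det_adjugate_toBlocks₁₁ {R p q : Type*} [CommRing R] [Fintype p] [Fintype q]
    [DecidableEq p] [DecidableEq q] [Nonempty p] (N : Matrix (p ⊕ q) (p ⊕ q) R) :
    N.adjugate.toBlocks₁₁.det = N.det ^ (Fintype.card p - 1) * N.toBlocks₂₂.det := by
  let X := mvPolynomialX (p ⊕ q) (p ⊕ q) ℤ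
  have hX : X.adjugate.toBlocks₁₁.det =
      X.det ^ (Fintype.card p - 1) * X.toBlocks₂₂.det := by
    refine mul_left_cancel₀ (det_mvPolynomialX_ne_zero (p ⊕ q) ℤ) ?_
    rw [det_mul_det_adjugate_toBlocks₁₁, ← mul_assoc, mul_pow_sub_one Fintype.card_ne_zero]
  let f := (MvPolynomial.aeval fun ij : (p ⊕ q) × (p ⊕ q) => N ij.1 ij.2 :
    MvPolynomial ((p ⊕ q) × (p ⊕ q)) ℤ →ₐ[ℤ] R).toRingHom
  have hN : f.mapMatrix X = N := mvPolynomialX_mapMatrix_aeval ℤ N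
  have h := congrArg f hX
  rw [map_mul, map_pow, RingHom.map_det, RingHom.map_det, RingHom.map_det, hN] at h
  have h₁ : f.mapMatrix X.adjugate.toBlocks₁₁ = N.adjugate.toBlocks₁₁ := by
    rw [← hN, ← RingHom.map_adjugate]
    rfl
  have h₂ : f.mapMatrix X.toBlocks₂₂ = N.toBlocks₂₂ := by
    rw [← hN]
    rfl
  rwa [h₁, h₂] at h

/-- Splits the two extreme indices of `Fin (m + 2)` from the inner ones. -/
noncomputable def endsSumInner (m : ℕ) : Fin 2 ⊕ Fin m ≃ Fin (m + 2) :=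
  Equiv.ofBijective (Sum.elim ![0, Fin.last (m + 1)] fun i => i.succ.castSucc) <| by
    rw [Fintype.bijective_iff_injective_and_card]
    refine ⟨?_, by simp [add_comm]⟩
    rintro (a | a) (b | b) h
    · fin_cases a <;> fin_cases b <;> simp_all [Fin.ext_iff]
    · fin_cases a <;> simp [Fin.ext_iff] at h
      omega
    · fin_cases b <;> simp [Fin.ext_iff] at h
      omega
    · simpa using h

/-- The Desnanot–Jacobi identity for the corner and inner minors of a square matrix. -/
theorem det_mul_det_inner {R : Type*} [CommRing R] {m : ℕ}
    (M : Matrix (Fin (m + 2)) (Fin (m + 2)) R) :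
    M.det * (M.submatrix (fun a : Fin m => a.succ.castSucc) fun a => a.succ.castSucc).det =
      (M.submatrix Fin.castSucc Fin.castSucc).det * (M.submatrix Fin.succ Fin.succ).det -
        (M.submatrix Fin.castSucc Fin.succ).det * (M.submatrix Fin.succ Fin.castSucc).det := by
  have h := det_adjugate_toBlocks₁₁ (M.submatrix (endsSumInner m) (endsSumInner m))
  rw [adjugate_submatrix_equiv_self, det_submatrix_equiv_self, det_fin_two] at h
  have h₀ : endsSumInner m (Sum.inl 0) = 0 := rfl
  have h₁ : endsSumInner m (Sum.inl 1) = Fin.last (m + 1) := rfl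
  have h₂ : (M.submatrix (endsSumInner m) (endsSumInner m)).toBlocks₂₂ =
    M.submatrix (fun a : Fin m => a.succ.castSucc) fun a => a.succ.castSucc := rfl
  have hs : ((-1 : R) ^ (m + 1)) * (-1) ^ (m + 1) = 1 := by
    rw [← mul_pow]
    simp
  simp only [toBlocks₁₁, of_apply, submatrix_apply, h₀, h₁, h₂,
    adjugate_fin_succ_eq_det_submatrix, Fin.succAbove_last, Fin.succAbove_zero,
    Fin.val_zero, Fin.val_last, Fintype.card_fin] at h
  linear_combination -h +
    ((M.submatrix Fin.castSucc Fin.castSucc).det * (M.submatrix Fin.succ Fin.succ).det -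
      (M.submatrix Fin.castSucc Fin.succ).det * (M.submatrix Fin.succ Fin.castSucc).det) * hs

end

/-- **Desnanot–Jacobi identity.** For an `n × n` matrix `A` over a commutative ring,
`det(A_{ij}^{(k+1)}) det(A_{i+1,j+1}^{(k-1)}) = det(A_{ij}^{(k)}) det(A_{i+1,j+1}^{(k)})
 - det(A_{i,j+1}^{(k)}) det(A_{i+1,j}^{(k)})` for all `k ≥ 1` and `1 ≤ i, j ≤ n - k`. -/
theorem desnanot_jacobi {R : Type*} [CommRing R] (n : ℕ) (hn : 1 ≤ n)
    (A : Matrix (Fin n) (Fin n) R) (k i j : ℕ) (hk : 1 ≤ k)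
    (hi : 1 ≤ i) (hi' : i ≤ n - k) (hj : 1 ≤ j) (hj' : j ≤ n - k) :
    subdet A i j (k + 1) * subdet A (i + 1) (j + 1) (k - 1)
      = subdet A i j k * subdet A (i + 1) (j + 1) k
        - subdet A i (j + 1) k * subdet A (i + 1) j k := by
  obtain ⟨m, rfl⟩ := Nat.exists_eq_add_of_le' hk
  obtain ⟨i, rfl⟩ := Nat.exists_eq_add_of_le' hi
  obtain ⟨j, rfl⟩ := Nat.exists_eq_add_of_le' hj
  have h := det_mul_det_inner (Matrix.of fun a b : Fin (m + 2) => entry A (i + a) (j + b))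
  simp only [Matrix.submatrix, Matrix.of_apply, Fin.val_castSucc, Fin.val_succ] at h
  simp only [← add_assoc] at h
  simp only [subdet, Nat.add_sub_cancel, add_right_comm _ 1]
  exact h

end Paper
end

section
/- Suppose M = (M_{ij}^{(k)}) is a three-dimensional array of real numbers indexed by integers satisfying the octahedron recurrence, and define z_{ij}^{(k)} = M_{k+2,i+k+1}^{(j−1)} / M_{k+1,i+k+1}^{(j)}. Fix integers i, j, k and assume that every entry of M occurring in the quotients z_{ij}^{(k)}, z_{i,j−1}^{(k)}, z_{i−1,j}^{(k)}, z_{i+1,j}^{(k−1)}, z_{i,j+1}^{(k−1)}, z_{ij}^{(k−1)} is positive. Then z_{ij}^{(k)} = (z_{i,j−1}^{(k)} + z_{i−1,j}^{(k)}) · (z_{i+1,j}^{(k−1)} ∥ z_{i,j+1}^{(k−1)}) / z_{ij}^{(k−1)}. -/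
namespace Paper

/-- The parallel sum `a ∥ b = ab/(a+b)`. -/
noncomputable def par (a b : ℝ) : ℝ := a * b / (a + b)

/-- The quotients `z_{ij}^{(k)} = M_{k+2, i+k+1}^{(j-1)} / M_{k+1, i+k+1}^{(j)}`,
where `M a b c` denotes `M_{ab}^{(c)}`. -/
noncomputable def zq (M : ℤ → ℤ → ℤ → ℝ) (i j k : ℤ) : ℝ :=
  M (k + 2) (i + k + 1) (j - 1) / M (k + 1) (i + k + 1) j

/-- Two three-term relations sharing the quantities `d` and `f` combine into a toggle
relation between quotients. -/
theorem div_eq_add_mul_par_div {a b c d e f g h p q : ℝ} (hb : 0 < b) (hd : 0 < d)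
    (hf : 0 < f) (hg : 0 < g) (hh : 0 < h) (hp : 0 < p) (hq : 0 < q)
    (hpa : p * a = d * e + f * c) (hqb : q * b = g * f + h * d) :
    a / b = (c / d + e / f) * par (d / g) (f / h) / (p / q) := by
  have hsum : c / d + e / f = p * a / (d * f) := by
    rw [hpa]
    field_simp
    ring
  have hpar : par (d / g) (f / h) = d * f / (q * b) := by
    rw [hqb, par]
    field_simp
    ring
  rw [hsum, hpar]
  field_simp

/-- If `M` satisfies the octahedron recurrence and all entries of `M` occurring in the
relevant quotients are positive, then
`z_{ij}^{(k)} = (z_{i,j-1}^{(k)} + z_{i-1,j}^{(k)}) (z_{i+1,j}^{(k-1)} ∥ z_{i,j+1}^{(k-1)})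
 / z_{ij}^{(k-1)}`. -/
theorem octahedron_toggle (M : ℤ → ℤ → ℤ → ℝ)
    (hoct : ∀ i j k : ℤ, M i j k * M (i + 1) (j + 1) k
      = M i (j + 1) k * M (i + 1) j k + M i j (k + 1) * M (i + 1) (j + 1) (k - 1))
    (i j k : ℤ)
    -- entries of z_{ij}^{(k)}
    (h1 : 0 < M (k + 2) (i + k + 1) (j - 1)) (h2 : 0 < M (k + 1) (i + k + 1) j)
    -- entries of z_{i,j-1}^{(k)}
    (h3 : 0 < M (k + 2) (i + k + 1) (j - 2)) (h4 : 0 < M (k + 1) (i + k + 1) (j - 1))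
    -- entries of z_{i-1,j}^{(k)}
    (h5 : 0 < M (k + 2) (i + k) (j - 1)) (h6 : 0 < M (k + 1) (i + k) j)
    -- remaining entry of z_{i+1,j}^{(k-1)}
    (h7 : 0 < M k (i + k + 1) j)
    -- remaining entry of z_{i,j+1}^{(k-1)}
    (h8 : 0 < M k (i + k) (j + 1))
    -- entries of z_{ij}^{(k-1)}
    (h9 : 0 < M (k + 1) (i + k) (j - 1)) (h10 : 0 < M k (i + k) j) :
    zq M i j k
      = (zq M i (j - 1) k + zq M (i - 1) j k)
          * par (zq M (i + 1) j (k - 1)) (zq M i (j + 1) (k - 1)) / zq M i j (k - 1) := by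
  have hlow := hoct k (i + k) j
  have hhigh := hoct (k + 1) (i + k) (j - 1)
  have e1 : k + 1 + 1 = k + 2 := by ring
  have e2 : j - 1 - 1 = j - 2 := by ring
  have e3 : j - 1 + 1 = j := by ring
  have e4 : i - 1 + k + 1 = i + k := by ring
  have e5 : k - 1 + 2 = k + 1 := by ring
  have e6 : k - 1 + 1 = k := by ring
  have e7 : i + 1 + (k - 1) + 1 = i + k + 1 := by ring
  have e8 : i + (k - 1) + 1 = i + k := by ring
  have e9 : j + 1 - 1 = j := by ring
  rw [e1, e2, e3] at hhigh
  simp only [zq, e2, e4, e5, e6, e7, e8, e9]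
  exact div_eq_add_mul_par_div h2 h4 h6 h7 h8 h9 h10 hhigh hlow

end Paper
end

section
/- Let R = [r] × [s] with labeling x and let 0 ≤ k ≤ s. There exists a bijection f from 𝒫_R^{(k)} (collections of k vertex-disjoint paths in R from (1,1),…,(1,k) to (r,s−k+1),…,(r,s)) to the set of collections of s−k pairwise vertex-disjoint directed paths in 𝒢_R from {P_{k+1}, P_{k+2}, …, P_s} to {Q_{r+1}, Q_{r+2}, …, Q_{r+s−k}}, such that for every ℒ ∈ 𝒫_R^{(k)} the weight of f(ℒ) (the product of the weights of all edges used) equals w(ℒ)/w_R(x), where w(ℒ) is the weight of ℒ and w_R(x) is the product of all labels of R. -/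
namespace Paper

/-- Membership in the rectangle poset `R = [1,r] × [1,s]` (coordinates in `ℤ`). -/
def inR (r s : ℕ) (p : ℤ × ℤ) : Prop :=
  1 ≤ p.1 ∧ p.1 ≤ (r : ℤ) ∧ 1 ≤ p.2 ∧ p.2 ≤ (s : ℤ)

instance (r s : ℕ) : DecidablePred (inR r s) := fun _ => by unfold inR; infer_instance

/-- The cover relation in the product of two chains. -/
def CoverStep (p q : ℤ × ℤ) : Prop :=
  (q.1 = p.1 + 1 ∧ q.2 = p.2) ∨ (q.1 = p.1 ∧ q.2 = p.2 + 1)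

/-- Upper covers of `p` inside the rectangle. -/
def upSet (r s : ℕ) (p : ℤ × ℤ) : Finset (ℤ × ℤ) :=
  ({(p.1 + 1, p.2), (p.1, p.2 + 1)} : Finset (ℤ × ℤ)).filter (inR r s)

/-- Lower covers of `p` inside the rectangle. -/
def downSet (r s : ℕ) (p : ℤ × ℤ) : Finset (ℤ × ℤ) :=
  ({(p.1 - 1, p.2), (p.1, p.2 - 1)} : Finset (ℤ × ℤ)).filter (inR r s)

/-- Sum of the labels of the lower covers of `p` (empty sum = 1). -/
noncomputable def dsum (r s : ℕ) (x : ℤ × ℤ → ℝ) (p : ℤ × ℤ) : ℝ :=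
  if (downSet r s p).Nonempty then ∑ q ∈ downSet r s p, x q else 1

/-- Parallel sum of the labels of the upper covers of `p` (empty parallel sum = 1). -/
noncomputable def usum (r s : ℕ) (x : ℤ × ℤ → ℝ) (p : ℤ × ℤ) : ℝ :=
  if (upSet r s p).Nonempty then (∑ q ∈ upSet r s p, (x q)⁻¹)⁻¹ else 1

/-- The birational toggle at `p`. -/
noncomputable def toggle (r s : ℕ) (p : ℤ × ℤ) (x : ℤ × ℤ → ℝ) : ℤ × ℤ → ℝ :=
  fun q => if q = p then usum r s x p * dsum r s x p / x p else x q

/-- The elements of `[1,a] × [1,b]` listed from top to bottom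
(descending lexicographic order, the reverse of a linear extension). -/
def rectList (a b : ℕ) : List (ℤ × ℤ) :=
  (List.range a).reverse.flatMap fun i =>
    (List.range b).reverse.map fun j => ((i : ℤ) + 1, (j : ℤ) + 1)

/-- Birational rowmotion on the rectangle: toggles from top to bottom. -/
noncomputable def rho (r s : ℕ) (x : ℤ × ℤ → ℝ) : ℤ × ℤ → ℝ :=
  (rectList r s).foldl (fun y p => toggle r s p y) x

/-- Inverse birational rowmotion: toggles from bottom to top. -/
noncomputable def rhoInv (r s : ℕ) (x : ℤ × ℤ → ℝ) : ℤ × ℤ → ℝ :=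
  (rectList r s).reverse.foldl (fun y p => toggle r s p y) x

/-- Integer powers of birational rowmotion. -/
noncomputable def rhoPow (r s : ℕ) (k : ℤ) (x : ℤ × ℤ → ℝ) : ℤ × ℤ → ℝ :=
  if 0 ≤ k then (rho r s)^[k.toNat] x else (rhoInv r s)^[(-k).toNat] x

/-- Saturated chains from `a` to `b`, as lists of successive cover steps. -/
def ChainList (a b : ℤ × ℤ) : Type :=
  {l : List (ℤ × ℤ) // l.Chain' CoverStep ∧ l.head? = some a ∧ l.getLast? = some b}

/-- The inverse birational transfer map on the rectangle: `φ⁻¹(x)_p` is the total weight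
of all saturated chains from the minimal element `(1,1)` to `p`. -/
noncomputable def phiInv (x : ℤ × ℤ → ℝ) : ℤ × ℤ → ℝ :=
  fun p => ∑ᶠ c : ChainList (1, 1) p, (c.1.map x).prod

/-- The birational transfer map `φ(x)_p = x_p / ∑_{q ⋖ p} x_q`. -/
noncomputable def phi (r s : ℕ) (x : ℤ × ℤ → ℝ) : ℤ × ℤ → ℝ :=
  fun p => x p / dsum r s x p

/-- A collection of `k` pairwise vertex-disjoint lattice paths in the interval
`[i₁,i₂] × [j₁,j₂]`, from `(i₁,j₁),…,(i₁,j₁+k-1)` to `(i₂,j₂-k+1),…,(i₂,j₂)`. -/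
structure RSys (i₁ i₂ j₁ j₂ : ℤ) (k : ℕ) where
  path : Fin k → List (ℤ × ℤ)
  chain : ∀ t, (path t).Chain' CoverStep
  mem : ∀ t, ∀ v ∈ path t, i₁ ≤ v.1 ∧ v.1 ≤ i₂ ∧ j₁ ≤ v.2 ∧ v.2 ≤ j₂
  first : ∀ t : Fin k, (path t).head? = some (i₁, j₁ + ((t : ℕ) : ℤ))
  final : ∀ t : Fin k, (path t).getLast? = some (i₂, j₂ - k + 1 + ((t : ℕ) : ℤ))
  disjoint : ∀ t t' : Fin k, t ≠ t' → ∀ v ∈ path t, v ∉ path t'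

/-- The weight of a collection of paths: the product of labels of all its elements. -/
noncomputable def RSysWeight (x : ℤ × ℤ → ℝ) {i₁ i₂ j₁ j₂ : ℤ} {k : ℕ}
    (L : RSys i₁ i₂ j₁ j₂ k) : ℝ :=
  ∏ t : Fin k, ((L.path t).map x).prod

/-- `w_I^{(k)}(x)`: total weight of all collections of `k` nonintersecting paths in the
interval `I = [i₁,i₂] × [j₁,j₂]` (with `w_I^{(0)} = 1`). -/
noncomputable def w (i₁ i₂ j₁ j₂ : ℤ) (k : ℤ) (x : ℤ × ℤ → ℝ) : ℝ :=
  if k ≤ 0 then 1 else ∑ᶠ L : RSys i₁ i₂ j₁ j₂ k.toNat, RSysWeight x L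

/-- `w_I(x)`: the product of all labels in the interval `I = [i₁,i₂] × [j₁,j₂]`. -/
noncomputable def wProd (i₁ i₂ j₁ j₂ : ℤ) (x : ℤ × ℤ → ℝ) : ℝ :=
  ∏ p ∈ Finset.Icc i₁ i₂ ×ˢ Finset.Icc j₁ j₂, x p

/-- The directed edges of the graph `𝒢_R` on vertex set `[1,r+1] × [1,s]`:
`(i,j) → (i+1,j)` for `(i,j) ∈ R`, and `(i,j) → (i+1,j-1)` when valid. -/
def GEdge (r s : ℕ) (p q : ℤ × ℤ) : Prop :=
  1 ≤ p.1 ∧ p.1 ≤ (r : ℤ) ∧ 1 ≤ p.2 ∧ p.2 ≤ (s : ℤ) ∧ q.1 = p.1 + 1 ∧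
    (q.2 = p.2 ∨ (q.2 = p.2 - 1 ∧ 2 ≤ p.2))

/-- The weight of an edge of `𝒢_R`: `x_p⁻¹` for vertical edges, `1` for diagonal ones. -/
noncomputable def edgeWt (x : ℤ × ℤ → ℝ) (p q : ℤ × ℤ) : ℝ :=
  if q.2 = p.2 then (x p)⁻¹ else 1

/-- The weight of a directed path in `𝒢_R`, given as its list of vertices. -/
noncomputable def listWt (x : ℤ × ℤ → ℝ) (l : List (ℤ × ℤ)) : ℝ :=
  ((l.zip l.tail).map fun e => edgeWt x e.1 e.2).prod

/-- The boundary vertex `P_t` of `𝒢_R`: `P_j = (1,j)` for `1 ≤ j ≤ s`, `P_{s+i} = (i+1,s)`. -/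
def Pvert (s : ℕ) (t : ℤ) : ℤ × ℤ := if t ≤ (s : ℤ) then (1, t) else (t - s + 1, (s : ℤ))

/-- The boundary vertex `Q_t` of `𝒢_R`: `Q_i = (i,1)` for `1 ≤ i ≤ r`, `Q_{r+j} = (r+1,j)`. -/
def Qvert (r : ℕ) (t : ℤ) : ℤ × ℤ := if t ≤ (r : ℤ) then (t, 1) else ((r : ℤ) + 1, t - r)

/-- A collection of `k` pairwise vertex-disjoint directed paths in `𝒢_R` from
`{P_i, …, P_{i+k-1}}` to `{Q_j, …, Q_{j+k-1}}`. -/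
structure GSys (r s : ℕ) (i j : ℤ) (k : ℕ) where
  perm : Equiv.Perm (Fin k)
  path : Fin k → List (ℤ × ℤ)
  chain : ∀ t, (path t).Chain' (GEdge r s)
  first : ∀ t : Fin k, (path t).head? = some (Pvert s (i + ((t : ℕ) : ℤ)))
  final : ∀ t : Fin k, (path t).getLast? = some (Qvert r (j + (((perm t) : ℕ) : ℤ)))
  disjoint : ∀ t t' : Fin k, t ≠ t' → ∀ v ∈ path t, v ∉ path t'

/-- The weight of a collection of paths in `𝒢_R`: the product of the weights of all
edges used. -/
noncomputable def GSysWeight (x : ℤ × ℤ → ℝ) {r s : ℕ} {i j : ℤ} {k : ℕ}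
    (L : GSys r s i j k) : ℝ :=
  ∏ t : Fin k, listWt x (L.path t)

/-- `W_{ij}^{(k)}(x)`: total weight of all collections of `k` nonintersecting paths in
`𝒢_R` from `{P_i,…,P_{i+k-1}}` to `{Q_j,…,Q_{j+k-1}}`; `W_{ij}^{(0)} = 1`, and `0` when an
out-of-range index occurs. -/
noncomputable def W (r s : ℕ) (x : ℤ × ℤ → ℝ) (i j k : ℤ) : ℝ :=
  if k < 0 then 0
  else if k = 0 then 1
  else if 1 ≤ i ∧ 1 ≤ j ∧ i + k - 1 ≤ (r : ℤ) + s ∧ j + k - 1 ≤ (r : ℤ) + s then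
    ∑ᶠ L : GSys r s i j k.toNat, GSysWeight x L
  else 0


/-! ### Complementary strictly increasing sequences -/

/-- The number of indices at which `a` takes a value at most `j`. -/
def countLE {n : ℕ} (a : Fin n → ℤ) (j : ℤ) : ℕ := (Finset.univ.filter fun t => a t ≤ j).card

theorem lt_countLE_iff {n : ℕ} {a : Fin n → ℤ} (ha : StrictMono a) (t : Fin n) (j : ℤ) :
    (t : ℕ) < countLE a j ↔ a t ≤ j := by
  constructor
  · intro h
    by_contra! hj
    have hsub : (Finset.univ.filter fun t => a t ≤ j) ⊆ Finset.Iio t := by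
      intro u hu
      simp only [Finset.mem_filter, Finset.mem_univ, true_and] at hu
      rw [Finset.mem_Iio, ← ha.lt_iff_lt]
      omega
    have := Finset.card_le_card hsub
    rw [Fin.card_Iio] at this
    unfold countLE at h
    omega
  · intro h
    have hsub : Finset.Iic t ⊆ (Finset.univ.filter fun t => a t ≤ j) := by
      intro u hu
      simp only [Finset.mem_filter, Finset.mem_univ, true_and]
      exact (ha.monotone (Finset.mem_Iic.1 hu)).trans h
    have := Finset.card_le_card hsub
    rw [Fin.card_Iic] at this
    unfold countLE
    omega

theorem countLE_le {n : ℕ} (a : Fin n → ℤ) (j : ℤ) : countLE a j ≤ n := by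
  simpa [countLE] using Finset.card_filter_le (Finset.univ : Finset (Fin n)) fun t => a t ≤ j

theorem countLE_mono {n : ℕ} {a b : Fin n → ℤ} {i j : ℤ} (h : ∀ t, a t ≤ i → b t ≤ j) :
    countLE a i ≤ countLE b j :=
  Finset.card_le_card fun t ht => by
    simp only [Finset.mem_filter, Finset.mem_univ, true_and] at ht ⊢
    exact h t ht

/-- `a` and `b` are the increasing enumerations of two complementary subsets of `[1, s]`. -/
structure Complementary (s : ℕ) {k m : ℕ} (a : Fin k → ℤ) (b : Fin m → ℤ) : Prop where
  strictMono_left : StrictMono a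
  strictMono_right : StrictMono b
  left_mem : ∀ t, a t ∈ Finset.Icc (1 : ℤ) s
  right_mem : ∀ u, b u ∈ Finset.Icc (1 : ℤ) s
  ne : ∀ t u, a t ≠ b u

namespace Complementary

variable {s k m : ℕ} {a : Fin k → ℤ} {b b' : Fin m → ℤ}

theorem symm (h : Complementary s a b) : Complementary s b a :=
  ⟨h.2, h.1, h.4, h.3, fun t u => (h.5 u t).symm⟩

theorem disjoint_image (h : Complementary s a b) (A : Finset (Fin k)) (B : Finset (Fin m)) :
    Disjoint (A.image a) (B.image b) := by
  rw [Finset.disjoint_left]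
  intro v hv hv'
  obtain ⟨t, -, rfl⟩ := Finset.mem_image.1 hv
  obtain ⟨u, -, hu⟩ := Finset.mem_image.1 hv'
  exact h.ne t u hu.symm

theorem image_union_image (h : Complementary s a b) (hs : k + m = s) :
    Finset.univ.image a ∪ Finset.univ.image b = Finset.Icc (1 : ℤ) s := by
  refine Finset.eq_of_subset_of_card_le ?_ ?_
  · intro v hv
    rcases Finset.mem_union.1 hv with hv | hv
    · obtain ⟨t, -, rfl⟩ := Finset.mem_image.1 hv
      exact h.left_mem t
    · obtain ⟨u, -, rfl⟩ := Finset.mem_image.1 hv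
      exact h.right_mem u
  · rw [Finset.card_union_of_disjoint (h.disjoint_image _ _),
      Finset.card_image_of_injective _ h.strictMono_left.injective,
      Finset.card_image_of_injective _ h.strictMono_right.injective]
    simp [hs]

theorem exists_eq (h : Complementary s a b) (hs : k + m = s) {j : ℤ} (h1 : 1 ≤ j) (hj : j ≤ s) :
    (∃ t, a t = j) ∨ ∃ u, b u = j := by
  have : j ∈ Finset.univ.image a ∪ Finset.univ.image b := by
    rw [h.image_union_image hs]
    exact Finset.mem_Icc.2 ⟨h1, hj⟩
  simpa using this

theorem countLE_add (h : Complementary s a b) (hs : k + m = s) {j : ℤ} (h0 : 0 ≤ j)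
    (hj : j ≤ s) : (countLE a j + countLE b j : ℤ) = j := by
  have hunion : (Finset.univ.filter fun t => a t ≤ j).image a ∪
      (Finset.univ.filter fun u => b u ≤ j).image b = Finset.Icc (1 : ℤ) j := by
    ext v
    simp only [Finset.mem_union, Finset.mem_image, Finset.mem_filter, Finset.mem_univ, true_and,
      Finset.mem_Icc]
    constructor
    · rintro (⟨t, ht, rfl⟩ | ⟨u, hu, rfl⟩)
      · exact ⟨(Finset.mem_Icc.1 (h.left_mem t)).1, ht⟩
      · exact ⟨(Finset.mem_Icc.1 (h.right_mem u)).1, hu⟩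
    · rintro ⟨h1, h2⟩
      rcases h.exists_eq hs h1 (h2.trans hj) with ⟨t, rfl⟩ | ⟨u, rfl⟩
      · exact Or.inl ⟨t, h2, rfl⟩
      · exact Or.inr ⟨u, h2, rfl⟩
  have := congrArg Finset.card hunion
  rw [Finset.card_union_of_disjoint (h.disjoint_image _ _),
    Finset.card_image_of_injective _ h.strictMono_left.injective,
    Finset.card_image_of_injective _ h.strictMono_right.injective, Int.card_Icc] at this
  unfold countLE
  omega

theorem right_unique (h : Complementary s a b) (h' : Complementary s a b') (hs : k + m = s) :
    b = b' := by
  rw [← h.strictMono_right.range_inj h'.strictMono_right]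
  ext v
  constructor
  · rintro ⟨u, rfl⟩
    obtain ⟨h1, h2⟩ := Finset.mem_Icc.1 (h.right_mem u)
    rcases h'.exists_eq hs h1 h2 with ⟨t, ht⟩ | hu
    · exact absurd ht (h.ne t u)
    · exact hu
  · rintro ⟨u, rfl⟩
    obtain ⟨h1, h2⟩ := Finset.mem_Icc.1 (h'.right_mem u)
    rcases h.exists_eq hs h1 h2 with ⟨t, ht⟩ | hu
    · exact absurd ht (h'.ne t u)
    · exact hu

theorem exists_right (hs : k + m = s) (ha : StrictMono a)
    (hmem : ∀ t, a t ∈ Finset.Icc (1 : ℤ) s) : ∃ b : Fin m → ℤ, Complementary s a b := by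
  have hcard : (Finset.Icc (1 : ℤ) s \ Finset.univ.image a).card = m := by
    rw [Finset.card_sdiff_of_subset, Finset.card_image_of_injective _ ha.injective]
    · simp
      omega
    · intro v hv
      obtain ⟨t, -, rfl⟩ := Finset.mem_image.1 hv
      exact hmem t
  have hb := fun u => Finset.mem_sdiff.1 (Finset.orderEmbOfFin_mem _ hcard u)
  refine ⟨Finset.orderEmbOfFin _ hcard, ha, OrderEmbedding.strictMono _, hmem,
    fun u => (hb u).1, fun t u htu => (hb u).2 ?_⟩
  rw [← htu]
  exact Finset.mem_image_of_mem _ (Finset.mem_univ t)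

theorem initial (hs : k + m = s) : Complementary s (fun t : Fin k => (1 + t : ℤ))
    fun u : Fin m => (k + 1 + u : ℤ) := by
  refine ⟨fun t t' h => ?_, fun t t' h => ?_, fun t => ?_, fun u => ?_, fun t u => ?_⟩
  · have : (t : ℕ) < t' := h
    omega
  · have : (t : ℕ) < t' := h
    omega
  · rw [Finset.mem_Icc]
    omega
  · rw [Finset.mem_Icc]
    omega
  · omega

theorem terminal (hs : k + m = s) : Complementary s (fun t : Fin k => (s - k + 1 + t : ℤ))
    fun u : Fin m => (1 + u : ℤ) := by
  have := (initial (k := m) (m := k) (s := s) (by omega)).symm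
  convert this using 3
  omega

end Complementary

/-- One row of a family of disjoint lattice paths: `a` and `a'` list the columns in which the paths
enter and leave the row. -/
def RowStep {k : ℕ} (a a' : Fin k → ℤ) : Prop :=
  (∀ t, a t ≤ a' t) ∧ ∀ t t', t < t' → a' t < a t'

/-- One row of a family of directed paths, each of which moves straight down or diagonally. -/
def DiagStep {m : ℕ} (b b' : Fin m → ℤ) : Prop :=
  ∀ u, b' u = b u ∨ b' u = b u - 1

namespace Complementary

variable {s k m : ℕ} {a a' : Fin k → ℤ} {b b' : Fin m → ℤ}

theorem rowStep_iff_diagStep (h : Complementary s a b) (h' : Complementary s a' b')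
    (hs : k + m = s) : RowStep a a' ↔ DiagStep b b' := by
  constructor
  · rintro ⟨hle, hlt⟩ u
    obtain ⟨hu1, hu2⟩ := Finset.mem_Icc.1 (h.right_mem u)
    obtain ⟨hu1', hu2'⟩ := Finset.mem_Icc.1 (h'.right_mem u)
    have hupper : b' u ≤ b u := by
      rw [← lt_countLE_iff h'.strictMono_right]
      have h1 := (lt_countLE_iff h.strictMono_right u (b u)).2 le_rfl
      have h2 : countLE a' (b u) ≤ countLE a (b u) := countLE_mono fun t => (hle t).trans
      have h3 := h.countLE_add hs (j := b u) (by omega) hu2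
      have h4 := h'.countLE_add hs (j := b u) (by omega) hu2
      omega
    have hlower : b u ≤ b' u + 1 := by
      by_cases hj : b' u + 1 ≤ s
      swap
      · omega
      rw [← lt_countLE_iff h.strictMono_right]
      have h1 := (lt_countLE_iff h'.strictMono_right u (b' u)).2 le_rfl
      have h3 := h.countLE_add hs (j := b' u + 1) (by omega) hj
      have h4 := h'.countLE_add hs (j := b' u) (by omega) hu2'
      by_contra hcon
      have hk := countLE_le a (b' u + 1)
      have hn : countLE a' (b' u) + 1 < countLE a (b' u + 1) := by omega
      have h5 := (lt_countLE_iff h.strictMono_left ⟨countLE a' (b' u) + 1, by omega⟩ _).1 hn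
      have h6 := hlt ⟨countLE a' (b' u), by omega⟩ ⟨countLE a' (b' u) + 1, by omega⟩
        (Fin.mk_lt_mk.2 (Nat.lt_succ_self _))
      have h7 := (lt_countLE_iff h'.strictMono_left ⟨countLE a' (b' u), by omega⟩ (b' u)).2
        (by omega)
      simp at h7
    omega
  · intro hstep
    refine ⟨fun t => ?_, fun t t' htt => ?_⟩
    · obtain ⟨ht1, ht2⟩ := Finset.mem_Icc.1 (h'.left_mem t)
      rw [← lt_countLE_iff h.strictMono_left]
      have h1 := (lt_countLE_iff h'.strictMono_left t (a' t)).2 le_rfl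
      have h2 : countLE b (a' t) ≤ countLE b' (a' t) := countLE_mono fun u hu => by
        rcases hstep u with h | h <;> omega
      have h3 := h.countLE_add hs (j := a' t) (by omega) ht2
      have h4 := h'.countLE_add hs (j := a' t) (by omega) ht2
      omega
    · obtain ⟨ht1, ht2⟩ := Finset.mem_Icc.1 (h.left_mem t')
      rw [← Int.le_sub_one_iff, ← lt_countLE_iff h'.strictMono_left]
      have h1 := (lt_countLE_iff h.strictMono_left t' (a t')).2 le_rfl
      have h2 : countLE b' (a t' - 1) ≤ countLE b (a t') := countLE_mono fun u hu => by
        rcases hstep u with h | h <;> omega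
      have h3 := h.countLE_add hs (j := a t') (by omega) ht2
      have h4 := h'.countLE_add hs (j := a t' - 1) (by omega) (by omega)
      have : (t : ℕ) < t' := htt
      omega

theorem exists_straight_iff (h : Complementary s a b) (h' : Complementary s a' b')
    (hs : k + m = s) (hstep : RowStep a a') {j : ℤ} (h1 : 1 ≤ j) (hj : j ≤ s) :
    (∃ u, b u = j ∧ b' u = j) ↔ ¬ ∃ t, a t ≤ j ∧ j ≤ a' t := by
  have h3 := h.countLE_add hs (j := j) (by omega) hj
  have h4 := h'.countLE_add hs (j := j) (by omega) hj
  constructor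
  · rintro ⟨u, rfl, hu'⟩ ⟨t, ht, ht'⟩
    have hle : countLE b (b u) = countLE b' (b u) := by
      have key : ∀ v, b v ≤ b u ↔ b' v ≤ b u := fun v => by
        rw [h.strictMono_right.le_iff_le, ← hu', h'.strictMono_right.le_iff_le]
      exact le_antisymm (countLE_mono fun v => (key v).1) (countLE_mono fun v => (key v).2)
    have h5 := (lt_countLE_iff h.strictMono_left t _).2 ht
    have h6 := (lt_countLE_iff h'.strictMono_left t (b u)).1 (by omega)
    exact h'.ne t u (by omega)
  · intro hno
    push Not at hno
    rcases h.exists_eq hs h1 hj with ⟨t, rfl⟩ | ⟨u, rfl⟩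
    · have := hno t le_rfl
      have := hstep.1 t
      omega
    refine ⟨u, rfl, ?_⟩
    have h5 : countLE a (b u) ≤ countLE a' (b u) := countLE_mono fun t ht => (hno t ht).le
    have h5' : countLE a' (b u) ≤ countLE a (b u) := countLE_mono fun t ht => (hstep.1 t).trans ht
    have h6 := (lt_countLE_iff h.strictMono_right u _).2 le_rfl
    have h7 := (lt_countLE_iff h'.strictMono_right u (b u)).1 (by omega)
    have h8 := (h.rowStep_iff_diagStep h' hs).1 hstep u
    rcases h'.exists_eq hs h1 hj with ⟨t, ht⟩ | ⟨v, hv⟩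
    · have := hno t (by have := hstep.1 t; omega)
      omega
    · by_contra hne
      have huv : u < v := by
        rw [← h'.strictMono_right.lt_iff_lt]
        omega
      have h9 := (lt_countLE_iff h'.strictMono_right v (b u)).2 hv.le
      have h10 := (lt_countLE_iff h.strictMono_right v (b u)).1 (by omega)
      have := h.strictMono_right huv
      omega

end Complementary

/-! ### Encoding of a path by its crossings between rows -/

theorem pairwise_of_isChain_coverStep {l : List (ℤ × ℤ)} (h : l.IsChain CoverStep) :
    l.Pairwise fun p q => p.1 + p.2 < q.1 + q.2 := by
  have : Trans (fun p q : ℤ × ℤ => p.1 + p.2 < q.1 + q.2)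
      (fun p q : ℤ × ℤ => p.1 + p.2 < q.1 + q.2)
      fun p q : ℤ × ℤ => p.1 + p.2 < q.1 + q.2 := ⟨lt_trans⟩
  rw [← List.isChain_iff_pairwise]
  refine h.imp fun p q hpq => ?_
  rcases hpq with h | h <;> omega

theorem nodup_of_isChain_coverStep {l : List (ℤ × ℤ)} (h : l.IsChain CoverStep) : l.Nodup :=
  (pairwise_of_isChain_coverStep h).imp fun {p q} hpq => by
    rintro rfl
    exact lt_irrefl _ hpq

theorem eq_of_isChain_coverStep {l l' : List (ℤ × ℤ)} (h : l.IsChain CoverStep)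
    (h' : l'.IsChain CoverStep) (hmem : ∀ v, v ∈ l ↔ v ∈ l') : l = l' :=
  List.Perm.eq_of_pairwise (fun _ _ _ _ hab hba => absurd hab hba.not_gt)
    (pairwise_of_isChain_coverStep h) (pairwise_of_isChain_coverStep h')
    ((List.perm_ext_iff_of_nodup (nodup_of_isChain_coverStep h)
      (nodup_of_isChain_coverStep h')).2 hmem)

/-- The cells of a lattice path that enters row `i + 1` in column `c i` and leaves it in column
`c (i + 1)`, for `i₀ ≤ i < r`. -/
def OnPath (i₀ r : ℕ) (c : ℕ → ℤ) (v : ℤ × ℤ) : Prop :=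
  ∃ i, i₀ ≤ i ∧ i < r ∧ v.1 = (i : ℤ) + 1 ∧ c i ≤ v.2 ∧ v.2 ≤ c (i + 1)

theorem onPath_iff_of_eqOn {i₀ r : ℕ} {c c' : ℕ → ℤ} (h : ∀ i, i₀ ≤ i → i ≤ r → c i = c' i)
    (v : ℤ × ℤ) : OnPath i₀ r c v ↔ OnPath i₀ r c' v := by
  refine exists_congr fun i => and_congr_right fun h1 => and_congr_right fun h2 => ?_
  rw [h i h1 h2.le, h (i + 1) (by omega) h2]

theorem exists_crossings {r : ℕ} {b : ℤ} {l : List (ℤ × ℤ)} {i₀ : ℕ} {a : ℤ}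
    (hl : l.IsChain CoverStep) (hfirst : l.head? = some ((i₀ : ℤ) + 1, a))
    (hfinal : l.getLast? = some ((r : ℤ), b)) :
    ∃ c : ℕ → ℤ, i₀ < r ∧ c i₀ = a ∧ c r = b ∧ (∀ i, i₀ ≤ i → i < r → c i ≤ c (i + 1)) ∧
      ∀ v, v ∈ l ↔ OnPath i₀ r c v := by
  induction l generalizing i₀ a with
  | nil => simp at hfirst
  | cons p l ih =>
    obtain rfl : p = ((i₀ : ℤ) + 1, a) := by simpa using hfirst
    cases l with
    | nil =>
      obtain ⟨h1, rfl⟩ : (i₀ : ℤ) + 1 = r ∧ a = b := by simpa using hfinal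
      obtain rfl : r = i₀ + 1 := by omega
      refine ⟨fun _ => a, by omega, rfl, rfl, fun _ _ _ => le_rfl, fun v => ?_⟩
      rw [List.mem_singleton, Prod.ext_iff]
      constructor
      · rintro ⟨h1, h2⟩
        exact ⟨i₀, le_rfl, by omega, h1, h2.ge, h2.le⟩
      · rintro ⟨i, h1, h2, h3, h4, h5⟩
        obtain rfl : i = i₀ := by omega
        exact ⟨h3, le_antisymm h5 h4⟩
    | cons q l =>
      rw [List.isChain_cons_cons] at hl
      obtain ⟨hpq, hl⟩ := hl
      rw [List.getLast?_cons_cons] at hfinal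
      rcases hpq with ⟨hq1, hq2⟩ | ⟨hq1, hq2⟩
      · obtain ⟨c, hi, hca, hcb, hmono, hmem⟩ := ih (i₀ := i₀ + 1) (a := a) hl
          (by simp [Prod.ext_iff, hq1, hq2]) hfinal
        refine ⟨fun i => if i ≤ i₀ then a else c i, by omega, by simp, ?_, ?_, ?_⟩
        · simp [hcb, show ¬ r ≤ i₀ by omega]
        · intro i h1 h2
          rcases h1.eq_or_lt with rfl | h1
          · simp [hca]
          · simpa [show ¬ i ≤ i₀ by omega, show ¬ i + 1 ≤ i₀ by omega] using hmono i h1 h2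
        · intro v
          rw [List.mem_cons, hmem, Prod.ext_iff]
          constructor
          · rintro (⟨h1, h2⟩ | ⟨i, h1, h2, h3, h4, h5⟩)
            · exact ⟨i₀, le_rfl, by omega, h1, by simp [h2], by simp [h2, hca]⟩
            · refine ⟨i, by omega, h2, h3, ?_, ?_⟩
              · simpa [show ¬ i ≤ i₀ by omega] using h4
              · simpa [show ¬ i + 1 ≤ i₀ by omega] using h5
          · rintro ⟨i, h1, h2, h3, h4, h5⟩
            rcases h1.eq_or_lt with rfl | h1
            · left
              simp [hca] at h4 h5
              exact ⟨h3, le_antisymm h5 h4⟩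
            · right
              simp only [show ¬ i ≤ i₀ by omega, show ¬ i + 1 ≤ i₀ by omega, if_false] at h4 h5
              exact ⟨i, h1, h2, h3, h4, h5⟩
      · obtain ⟨c, hi, hca, hcb, hmono, hmem⟩ := ih (i₀ := i₀) (a := a + 1) hl
          (by simp [Prod.ext_iff, hq1, hq2]) hfinal
        refine ⟨fun i => if i ≤ i₀ then a else c i, by omega, by simp, ?_, ?_, ?_⟩
        · simp [hcb, show ¬ r ≤ i₀ by omega]
        · intro i h1 h2
          have := hmono i h1 h2
          rcases h1.eq_or_lt with rfl | h1
          · simp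
            omega
          · simpa [show ¬ i ≤ i₀ by omega, show ¬ i + 1 ≤ i₀ by omega] using this
        · intro v
          rw [List.mem_cons, hmem, Prod.ext_iff]
          constructor
          · rintro (⟨h1, h2⟩ | ⟨i, h1, h2, h3, h4, h5⟩)
            · refine ⟨i₀, le_rfl, by omega, h1, by simp [h2], ?_⟩
              have := hmono i₀ le_rfl hi
              simp at h2 ⊢
              omega
            · refine ⟨i, by omega, h2, h3, ?_, ?_⟩
              · rcases h1.eq_or_lt with rfl | h1
                · simp
                  omega
                · simpa [show ¬ i ≤ i₀ by omega] using h4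
              · simpa [show ¬ i + 1 ≤ i₀ by omega] using h5
          · rintro ⟨i, h1, h2, h3, h4, h5⟩
            simp only [show ¬ i + 1 ≤ i₀ by omega, if_false] at h5
            rcases h1.eq_or_lt with rfl | h1
            · simp at h4
              rcases h4.eq_or_lt with h4 | h4
              · exact Or.inl ⟨h3, h4.symm⟩
              · exact Or.inr ⟨i₀, le_rfl, h2, h3, by omega, h5⟩
            · right
              simp only [show ¬ i ≤ i₀ by omega, if_false] at h4
              exact ⟨i, h1.le, h2, h3, h4, h5⟩

theorem le_of_forall_le_succ {i₀ r : ℕ} {c : ℕ → ℤ}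
    (hc : ∀ i, i₀ ≤ i → i < r → c i ≤ c (i + 1)) {i j : ℕ} (hi : i₀ ≤ i) (hij : i ≤ j)
    (hj : j ≤ r) : c i ≤ c j := by
  induction j, hij using Nat.le_induction with
  | base => exact le_rfl
  | succ j hij ih => exact (ih (by omega)).trans (hc j (by omega) (by omega))

theorem exists_list_of_crossings {r i₀ : ℕ} (hi : i₀ < r) (c : ℕ → ℤ)
    (hc : ∀ i, i₀ ≤ i → i < r → c i ≤ c (i + 1)) :
    ∃ l : List (ℤ × ℤ), l.IsChain CoverStep ∧ l.head? = some ((i₀ : ℤ) + 1, c i₀) ∧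
      l.getLast? = some ((r : ℤ), c r) ∧ ∀ v, v ∈ l ↔ OnPath i₀ r c v := by
  obtain ⟨N, hN⟩ : ∃ N, r - i₀ + (c r - c i₀).toNat = N := ⟨_, rfl⟩
  induction N using Nat.strong_induction_on generalizing i₀ c with
  | _ N ih =>
    have h0 := hc i₀ le_rfl hi
    have h1 := le_of_forall_le_succ hc (i := i₀ + 1) (j := r) (by omega) (by omega) le_rfl
    rcases h0.eq_or_lt with heq | hlt
    · by_cases hr : i₀ + 1 = r
      · subst hr
        refine ⟨[((i₀ : ℤ) + 1, c i₀)], List.isChain_singleton _, rfl, by simp [heq], fun v => ?_⟩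
        rw [List.mem_singleton, Prod.ext_iff]
        constructor
        · rintro ⟨h1, h2⟩
          exact ⟨i₀, le_rfl, by omega, h1, h2.ge, h2.le.trans heq.le⟩
        · rintro ⟨i, h1, h2, h3, h4, h5⟩
          obtain rfl : i = i₀ := by omega
          exact ⟨h3, le_antisymm (h5.trans heq.ge) h4⟩
      · obtain ⟨l, hl, hfirst, hfinal, hmem⟩ := ih _ (by omega) (i₀ := i₀ + 1) (by omega) c
          (fun i h => hc i (by omega)) rfl
        obtain ⟨q, l, rfl⟩ : ∃ q l', l = q :: l' := by
          cases l with
          | nil => simp at hfirst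
          | cons q l => exact ⟨q, l, rfl⟩
        obtain rfl : q = (((i₀ + 1 : ℕ) : ℤ) + 1, c (i₀ + 1)) := by simpa using hfirst
        refine ⟨((i₀ : ℤ) + 1, c i₀) :: _ :: l, List.isChain_cons_cons.2 ⟨?_, hl⟩, rfl, ?_,
          fun v => ?_⟩
        · left
          simp [heq]
        · rwa [List.getLast?_cons_cons]
        · rw [List.mem_cons, hmem, Prod.ext_iff]
          constructor
          · rintro (⟨h1, h2⟩ | ⟨i, h1, h2, h3, h4, h5⟩)
            · exact ⟨i₀, le_rfl, by omega, h1, h2.ge, h2.le.trans heq.le⟩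
            · exact ⟨i, by omega, h2, h3, h4, h5⟩
          · rintro ⟨i, h1, h2, h3, h4, h5⟩
            rcases h1.eq_or_lt with rfl | h1
            · exact Or.inl ⟨h3, le_antisymm (h5.trans heq.ge) h4⟩
            · exact Or.inr ⟨i, h1, h2, h3, h4, h5⟩
    · have hupd : ∀ i, i₀ < i → Function.update c i₀ (c i₀ + 1) i = c i := fun i hi =>
        Function.update_of_ne (by omega) _ _
      obtain ⟨l, hl, hfirst, hfinal, hmem⟩ := ih (r - i₀ + (c r - (c i₀ + 1)).toNat) (by omega)
        (i₀ := i₀) hi (Function.update c i₀ (c i₀ + 1))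
        (fun i h1 h2 => by
          rw [hupd (i + 1) (by omega)]
          rcases h1.eq_or_lt with rfl | h1
          · simpa using hlt
          · rw [hupd i h1]
            exact hc i h1.le h2)
        (by simp [hupd r hi])
      rw [Function.update_self] at hfirst
      obtain ⟨q, l, rfl⟩ : ∃ q l', l = q :: l' := by
        cases l with
        | nil => simp at hfirst
        | cons q l => exact ⟨q, l, rfl⟩
      obtain rfl : q = ((i₀ : ℤ) + 1, c i₀ + 1) := by simpa using hfirst
      refine ⟨((i₀ : ℤ) + 1, c i₀) :: _ :: l, List.isChain_cons_cons.2 ⟨?_, hl⟩, rfl, ?_,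
        fun v => ?_⟩
      · right
        simp
      · rwa [List.getLast?_cons_cons, hfinal, hupd]
      · rw [List.mem_cons, hmem, Prod.ext_iff]
        constructor
        · rintro (⟨h1, h2⟩ | ⟨i, h1, h2, h3, h4, h5⟩)
          · exact ⟨i₀, le_rfl, by omega, h1, h2.ge, h2.le.trans h0⟩
          · rw [hupd (i + 1) (by omega)] at h5
            refine ⟨i, h1, h2, h3, ?_, h5⟩
            rcases h1.eq_or_lt with rfl | h1
            · rw [Function.update_self] at h4
              omega
            · rwa [hupd i h1] at h4
        · rintro ⟨i, h1, h2, h3, h4, h5⟩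
          rw [← hupd (i + 1) (by omega)] at h5
          rcases h1.eq_or_lt with rfl | h1
          · rcases h4.eq_or_lt with h4 | h4
            · exact Or.inl ⟨h3, h4.symm⟩
            · refine Or.inr ⟨i₀, le_rfl, h2, h3, ?_, h5⟩
              rw [Function.update_self]
              omega
          · rw [← hupd i h1] at h4
            exact Or.inr ⟨i, h1.le, h2, h3, h4, h5⟩

/-! ### Families of crossings -/

/-- The crossing columns of `k` disjoint lattice paths in `[r] × [s]`, row by row. -/
structure IsRowFamily (r s : ℕ) {k : ℕ} (c : ℕ → Fin k → ℤ) : Prop where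
  start : ∀ t, c 0 t = 1 + t
  finish : ∀ t, c r t = s - k + 1 + t
  step : ∀ i < r, RowStep (c i) (c (i + 1))

/-- The columns visited by `m` disjoint directed paths in `𝒢_R`, row by row. -/
structure IsDiagFamily (r s k : ℕ) {m : ℕ} (h : ℕ → Fin m → ℤ) : Prop where
  start : ∀ u, h 0 u = k + 1 + u
  finish : ∀ u, h r u = 1 + u
  step : ∀ i < r, DiagStep (h i) (h (i + 1))
  strictMono : ∀ i ≤ r, StrictMono (h i)
  mem : ∀ i ≤ r, ∀ u, h i u ∈ Finset.Icc (1 : ℤ) s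

namespace IsRowFamily

variable {r s k m : ℕ} {c : ℕ → Fin k → ℤ} {h : ℕ → Fin m → ℤ}

theorem strictMono (hc : IsRowFamily r s c) {i : ℕ} (hi : i ≤ r) : StrictMono (c i) := by
  intro t t' htt
  have : (t : ℕ) < t' := htt
  rcases hi.eq_or_lt with rfl | hi
  · rw [hc.finish, hc.finish]
    omega
  · exact ((hc.step i hi).1 t).trans_lt ((hc.step i hi).2 t t' htt)

theorem mem (hc : IsRowFamily r s c) {i : ℕ} (hi : i ≤ r) (t : Fin k) :
    c i t ∈ Finset.Icc (1 : ℤ) s := by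
  have hstep : ∀ i, 0 ≤ i → i < r → c i t ≤ c (i + 1) t := fun i _ hi => (hc.step i hi).1 t
  have h1 := le_of_forall_le_succ (c := fun i => c i t) hstep le_rfl (Nat.zero_le i) hi
  have h2 := le_of_forall_le_succ (c := fun i => c i t) hstep (Nat.zero_le i) hi le_rfl
  have h3 := hc.start t
  have h4 := hc.finish t
  rw [Finset.mem_Icc]
  omega

theorem isDiagFamily (hc : IsRowFamily r s c) (hs : k + m = s)
    (hcompl : ∀ i ≤ r, Complementary s (c i) (h i)) : IsDiagFamily r s k h where
  start u := by
    have h0 := hcompl 0 (Nat.zero_le r)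
    rw [funext hc.start] at h0
    exact congrFun (h0.right_unique (Complementary.initial hs) hs) u
  finish u := by
    have h0 := hcompl r le_rfl
    rw [funext hc.finish] at h0
    exact congrFun (h0.right_unique (Complementary.terminal hs) hs) u
  step i hi :=
    ((hcompl i hi.le).rowStep_iff_diagStep (hcompl (i + 1) hi) hs).1 (hc.step i hi)
  strictMono i hi := (hcompl i hi).strictMono_right
  mem i hi := (hcompl i hi).right_mem

theorem exists_complementary (hc : IsRowFamily r s c) (hs : k + m = s) :
    ∃ h : ℕ → Fin m → ℤ, ∀ i ≤ r, Complementary s (c i) (h i) := by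
  have : ∀ i, ∃ b : Fin m → ℤ, i ≤ r → Complementary s (c i) b := fun i => by
    by_cases hi : i ≤ r
    · obtain ⟨b, hb⟩ := Complementary.exists_right hs (hc.strictMono hi) (hc.mem hi)
      exact ⟨b, fun _ => hb⟩
    · exact ⟨0, fun h => absurd h hi⟩
  choose h hh using this
  exact ⟨h, hh⟩

end IsRowFamily

namespace IsDiagFamily

variable {r s k m : ℕ} {c : ℕ → Fin k → ℤ} {h : ℕ → Fin m → ℤ}

theorem isRowFamily (hh : IsDiagFamily r s k h) (hs : k + m = s)
    (hcompl : ∀ i ≤ r, Complementary s (c i) (h i)) : IsRowFamily r s c where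
  start t := by
    have h0 := (hcompl 0 (Nat.zero_le r)).symm
    rw [funext hh.start] at h0
    exact congrFun (h0.right_unique (Complementary.initial hs).symm (by omega)) t
  finish t := by
    have h0 := (hcompl r le_rfl).symm
    rw [funext hh.finish] at h0
    exact congrFun (h0.right_unique (Complementary.terminal hs).symm (by omega)) t
  step i hi :=
    ((hcompl i hi.le).rowStep_iff_diagStep (hcompl (i + 1) hi) hs).2 (hh.step i hi)

theorem exists_complementary (hh : IsDiagFamily r s k h) (hs : k + m = s) :
    ∃ c : ℕ → Fin k → ℤ, ∀ i ≤ r, Complementary s (c i) (h i) := by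
  have : ∀ i, ∃ a : Fin k → ℤ, i ≤ r → Complementary s a (h i) := fun i => by
    by_cases hi : i ≤ r
    · obtain ⟨a, ha⟩ := Complementary.exists_right (m := k) (by omega) (hh.strictMono i hi)
        (hh.mem i hi)
      exact ⟨a, fun _ => ha.symm⟩
    · exact ⟨0, fun h => absurd h hi⟩
  choose c hc using this
  exact ⟨c, hc⟩

end IsDiagFamily

/-! ### Path systems in the rectangle -/

theorem RSys.ext_path {i₁ i₂ j₁ j₂ : ℤ} {k : ℕ} {L L' : RSys i₁ i₂ j₁ j₂ k}
    (h : L.path = L'.path) : L = L' := by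
  cases L
  cases L'
  congr

/-- `c` lists the crossing columns of the paths of `L`. -/
structure RSys.Encodes {r s k : ℕ} (L : RSys 1 r 1 s k) (c : ℕ → Fin k → ℤ) : Prop
    extends IsRowFamily r s c where
  mem_iff : ∀ t v, v ∈ L.path t ↔ OnPath 0 r (fun i => c i t) v

namespace RSys

variable {r s k : ℕ}

theorem exists_encodes (L : RSys 1 r 1 s k) : ∃ c, L.Encodes c := by
  have hex := fun t : Fin k => exists_crossings (i₀ := 0) (a := 1 + (t : ℕ)) (L.chain t)
    (by simpa using L.first t) (L.final t)
  choose c hr hstart hfinish hmono hmem using hex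
  refine ⟨fun i t => c t i, ⟨hstart, hfinish, ?_⟩, hmem⟩
  suffices hlt : ∀ i, i < r → (∀ t t', t < t' → c t i < c t' i) →
      ∀ t t', t < t' → c t (i + 1) < c t' i by
    have hinc : ∀ i ≤ r, ∀ t t', t < t' → c t i < c t' i := by
      intro i
      induction i with
      | zero =>
        intro _ t t' htt
        have : (t : ℕ) < t' := htt
        rw [hstart, hstart]
        omega
      | succ i ih =>
        intro hi t t' htt
        exact (hlt i hi (ih (by omega)) t t' htt).trans_le (hmono t' i (Nat.zero_le i) hi)
    exact fun i hi => ⟨fun t => hmono t i (Nat.zero_le i) hi, hlt i hi (hinc i hi.le)⟩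
  intro i hi hinc t t' htt
  by_contra! hle
  refine L.disjoint t t' htt.ne ((i : ℤ) + 1, c t' i) ?_ ?_
  · rw [hmem]
    exact ⟨i, Nat.zero_le i, hi, rfl, (hinc t t' htt).le, hle⟩
  · rw [hmem]
    exact ⟨i, Nat.zero_le i, hi, rfl, le_rfl, hmono t' i (Nat.zero_le i) hi⟩

theorem exists_of_isRowFamily (hr : 1 ≤ r) {c : ℕ → Fin k → ℤ}
    (hc : IsRowFamily r s c) : ∃ L : RSys 1 r 1 s k, L.Encodes c := by
  have hex := fun t => exists_list_of_crossings (i₀ := 0) hr (fun i => c i t)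
    fun i _ hi => (hc.step i hi).1 t
  choose l hchain hfirst hfinal hmem using hex
  refine ⟨⟨l, hchain, ?_, ?_, ?_, ?_⟩, hc, hmem⟩
  · intro t v hv
    obtain ⟨i, -, hi, h1, h2, h3⟩ := (hmem t v).1 hv
    replace h2 : c i t ≤ v.2 := h2
    replace h3 : v.2 ≤ c (i + 1) t := h3
    have h4 := Finset.mem_Icc.1 (hc.mem hi.le t)
    have h5 := Finset.mem_Icc.1 (hc.mem (i := i + 1) hi t)
    omega
  · intro t
    simp [hfirst, hc.start]
  · intro t
    simp [hfinal, hc.finish]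
  · have hlt : ∀ t t', t < t' → ∀ v ∈ l t, v ∉ l t' := by
      intro t t' htt v hv hv'
      obtain ⟨i, -, hi, h1, h2, h3⟩ := (hmem t v).1 hv
      obtain ⟨i', -, -, h1', h2', h3'⟩ := (hmem t' v).1 hv'
      obtain rfl : i' = i := by omega
      replace h3 : v.2 ≤ c (i' + 1) t := h3
      replace h2' : c i' t' ≤ v.2 := h2'
      have := (hc.step i' hi).2 t t' htt
      omega
    intro t t' hne v hv hv'
    rcases lt_or_gt_of_ne hne with h | h
    · exact hlt t t' h v hv hv'
    · exact hlt t' t h v hv' hv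

theorem Encodes.eqOn {L : RSys 1 r 1 s k} {c c' : ℕ → Fin k → ℤ} (hc : L.Encodes c)
    (hc' : L.Encodes c') : ∀ i ≤ r, c i = c' i := by
  have hle : ∀ {c c' : ℕ → Fin k → ℤ}, L.Encodes c → L.Encodes c' → ∀ i < r, ∀ t,
      c' i t ≤ c i t := by
    intro c c' hc hc' i hi t
    have : ((i : ℤ) + 1, c i t) ∈ L.path t := by
      rw [hc.mem_iff]
      exact ⟨i, Nat.zero_le i, hi, rfl, le_rfl, (hc.step i hi).1 t⟩
    obtain ⟨i', -, -, h1, h2, -⟩ := (hc'.mem_iff t _).1 this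
    obtain rfl : i' = i := by simpa using h1.symm
    exact h2
  intro i hi
  ext t
  rcases hi.eq_or_lt with rfl | hi
  · rw [hc.finish, hc'.finish]
  · exact le_antisymm (hle hc' hc i hi t) (hle hc hc' i hi t)

theorem Encodes.eq_of_eqOn {L L' : RSys 1 r 1 s k} {c c' : ℕ → Fin k → ℤ} (hc : L.Encodes c)
    (hc' : L'.Encodes c') (h : ∀ i ≤ r, c i = c' i) : L = L' := by
  refine ext_path (funext fun t => eq_of_isChain_coverStep (L.chain t) (L'.chain t) fun v => ?_)
  rw [hc.mem_iff, hc'.mem_iff]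
  exact onPath_iff_of_eqOn (fun i _ hi => congrFun (h i hi) t) v

end RSys

/-! ### Path systems in the graph -/

/-- The vertices of a directed path of `𝒢_R` that visits row `i + 1` in column `h i`. -/
def pathList (r : ℕ) (h : ℕ → ℤ) : List (ℤ × ℤ) :=
  (List.range (r + 1)).map fun i : ℕ => ((i : ℤ) + 1, h i)

theorem mem_pathList {r : ℕ} {h : ℕ → ℤ} {v : ℤ × ℤ} :
    v ∈ pathList r h ↔ ∃ i ≤ r, ((i : ℤ) + 1, h i) = v := by
  simp [pathList]

theorem pathList_congr {r : ℕ} {h h' : ℕ → ℤ} (heq : ∀ i ≤ r, h i = h' i) :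
    pathList r h = pathList r h' :=
  List.map_congr_left fun i hi => by rw [heq i (Nat.lt_succ_iff.1 (List.mem_range.1 hi))]

theorem eqOn_of_pathList_eq {r : ℕ} {h h' : ℕ → ℤ} (heq : pathList r h = pathList r h') :
    ∀ i ≤ r, h i = h' i := by
  intro i hi
  have := List.map_inj_left.1 heq i (List.mem_range.2 (Nat.lt_succ_iff.2 hi))
  exact (Prod.ext_iff.1 this).2

theorem head?_pathList (r : ℕ) (h : ℕ → ℤ) : (pathList r h).head? = some (1, h 0) := by
  simp [pathList, List.head?_range]

theorem getLast?_pathList (r : ℕ) (h : ℕ → ℤ) :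
    (pathList r h).getLast? = some ((r : ℤ) + 1, h r) := by
  simp [pathList, List.getLast?_range]

theorem isChain_pathList {R : ℤ × ℤ → ℤ × ℤ → Prop} {r : ℕ} {h : ℕ → ℤ} :
    (pathList r h).IsChain R ↔ ∀ i < r, R ((i : ℤ) + 1, h i) (((i + 1 : ℕ) : ℤ) + 1, h (i + 1)) := by
  rw [pathList, List.isChain_map]
  exact List.isChain_range_succ _ r

theorem exists_eq_pathList {R : ℤ × ℤ → ℤ × ℤ → Prop} (hR : ∀ p q, R p q → q.1 = p.1 + 1)
    {l : List (ℤ × ℤ)} (hl : l.IsChain R) {r : ℕ} {a b : ℤ} (hfirst : l.head? = some (1, a))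
    (hfinal : l.getLast? = some ((r : ℤ) + 1, b)) : ∃ h, l = pathList r h := by
  have hrow : ∀ i (hi : i < l.length), l[i].1 = (i : ℤ) + 1 := by
    intro i
    induction i with
    | zero =>
      intro hi
      rw [List.head?_eq_getElem?, List.getElem?_eq_getElem hi] at hfirst
      simp [Option.some_inj.1 hfirst]
    | succ i ih =>
      intro hi
      rw [hR _ _ (List.isChain_iff_getElem.1 hl i hi), ih]
      simp
  have hlen : l.length = r + 1 := by
    have hpos : l.length - 1 < l.length := by
      have : l ≠ [] := by
        rintro rfl
        simp at hfirst
      have := List.length_pos_iff.2 this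
      omega
    rw [List.getLast?_eq_getElem?, List.getElem?_eq_getElem hpos] at hfinal
    have := hrow _ hpos
    rw [Option.some_inj.1 hfinal] at this
    simp only at this
    omega
  refine ⟨fun i => (l.getD i 0).2, List.ext_getElem (by simp [pathList, hlen]) fun i hi _ => ?_⟩
  simp [pathList, Prod.ext_iff, hrow, hi]

theorem listWt_pathList (x : ℤ × ℤ → ℝ) (r : ℕ) (h : ℕ → ℤ) :
    listWt x (pathList r h) =
      ∏ i ∈ Finset.range r, if h (i + 1) = h i then (x ((i : ℤ) + 1, h i))⁻¹ else 1 := by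
  have key : ∀ (n : ℕ) (g : ℕ → ℤ × ℤ), listWt x ((List.range (n + 1)).map g) =
      ∏ i ∈ Finset.range n, edgeWt x (g i) (g (i + 1)) := by
    intro n
    induction n with
    | zero => simp [listWt]
    | succ n ih =>
      intro g
      have hcons : ∀ p q l, listWt x (p :: q :: l) = edgeWt x p q * listWt x (q :: l) := by
        simp [listWt]
      have htail := ih fun i => g (i + 1)
      rw [List.range_succ_eq_map, List.map_cons, List.map_map] at htail ⊢
      rw [List.range_succ_eq_map, List.map_cons, List.map_map, hcons, Finset.prod_range_succ',
        mul_comm, ← htail]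
      rfl
  exact key r _

namespace GSys

variable {r s k m : ℕ}

theorem ext_path {r s : ℕ} {i : ℤ} {m : ℕ} {M M' : GSys r s i ((r : ℤ) + 1) m}
    (h : M.path = M'.path) : M = M' := by
  have hperm : M.perm = M'.perm := by
    ext u
    have := (M.final u).symm.trans ((congrArg List.getLast? (congrFun h u)).trans (M'.final u))
    rw [Option.some_inj, Qvert, Qvert, if_neg (by omega), if_neg (by omega), Prod.ext_iff] at this
    simp only at this
    omega
  cases M
  cases M'
  congr

/-- `h` lists the columns visited by the paths of `M`. -/
structure Encodes (M : GSys r s ((k : ℤ) + 1) ((r : ℤ) + 1) m) (h : ℕ → Fin m → ℤ) : Prop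
    extends IsDiagFamily r s k h where
  path_eq : ∀ u, M.path u = pathList r fun i => h i u

theorem exists_encodes (hs : k + m = s) (M : GSys r s ((k : ℤ) + 1) ((r : ℤ) + 1) m) :
    ∃ h, M.Encodes h := by
  have hP : ∀ u : Fin m, Pvert s ((k : ℤ) + 1 + (u : ℕ)) = (1, (k : ℤ) + 1 + (u : ℕ)) :=
    fun u => if_pos (by omega)
  have hQ : ∀ u : Fin m, Qvert r ((r : ℤ) + 1 + (M.perm u : ℕ)) =
      ((r : ℤ) + 1, (1 : ℤ) + (M.perm u : ℕ)) := fun u => by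
    rw [Qvert, if_neg (by omega)]
    congr 1
    ring
  have hfirst := fun u => (M.first u).trans (congrArg some (hP u))
  have hfinal := fun u => (M.final u).trans (congrArg some (hQ u))
  have hex := fun u => exists_eq_pathList (fun p q h => h.2.2.2.2.1) (M.chain u) (hfirst u)
    (hfinal u)
  choose h hpath using hex
  have hstart : ∀ u, h u 0 = k + 1 + (u : ℕ) := fun u => by
    have := hfirst u
    rw [hpath, head?_pathList] at this
    simpa using this
  have hlast : ∀ u, h u r = 1 + (M.perm u : ℕ) := fun u => by
    have := hfinal u
    rw [hpath, getLast?_pathList] at this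
    simpa using this
  have hedge : ∀ u, ∀ i < r, GEdge r s ((i : ℤ) + 1, h u i)
      (((i + 1 : ℕ) : ℤ) + 1, h u (i + 1)) := fun u => by
    have := M.chain u
    rw [hpath] at this
    exact isChain_pathList.1 this
  have hstep : ∀ i < r, DiagStep (fun u => h u i) fun u => h u (i + 1) := fun i hi u =>
    (hedge u i hi).2.2.2.2.2.imp id And.left
  have hne : ∀ i ≤ r, ∀ u u', u ≠ u' → h u i ≠ h u' i := fun i hi u u' huu heq => by
    refine M.disjoint u u' huu ((i : ℤ) + 1, h u i) ?_ ?_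
    · rw [hpath]
      exact mem_pathList.2 ⟨i, hi, rfl⟩
    · rw [hpath]
      exact mem_pathList.2 ⟨i, hi, by rw [heq]⟩
  have hmono : ∀ i ≤ r, StrictMono fun u => h u i := by
    intro i
    induction i with
    | zero =>
      intro _ u u' huu
      have : (u : ℕ) < u' := huu
      simp only [hstart]
      omega
    | succ i ih =>
      intro hi u u' huu
      have h1 : h u i < h u' i := ih (by omega) huu
      have h2 : h u (i + 1) = h u i ∨ h u (i + 1) = h u i - 1 := hstep i hi u
      have h3 : h u' (i + 1) = h u' i ∨ h u' (i + 1) = h u' i - 1 := hstep i hi u'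
      have h4 := hne (i + 1) hi u u' huu.ne
      show h u (i + 1) < h u' (i + 1)
      omega
  have hlastCompl : Complementary s (fun t : Fin k => (s - k + 1 + t : ℤ)) fun u => h u r := by
    have hterm := Complementary.terminal (k := k) (m := m) (s := s) hs
    refine ⟨hterm.strictMono_left, hmono r le_rfl, hterm.left_mem, fun u => ?_, fun t u => ?_⟩
    · rw [Finset.mem_Icc]
      simp only [hlast]
      omega
    · simp only [hlast]
      omega
  refine ⟨fun i u => h u i, ⟨hstart, fun u => ?_, hstep, hmono, fun i hi u => ?_⟩, hpath⟩
  · exact congrFun (hlastCompl.right_unique (Complementary.terminal hs) hs) u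
  · rcases hi.eq_or_lt with rfl | hi
    · exact hlastCompl.right_mem u
    · obtain ⟨-, -, h1, h2, -⟩ := hedge u i hi
      exact Finset.mem_Icc.2 ⟨h1, h2⟩

theorem exists_of_isDiagFamily (hs : k + m = s) {h : ℕ → Fin m → ℤ}
    (hh : IsDiagFamily r s k h) :
    ∃ M : GSys r s ((k : ℤ) + 1) ((r : ℤ) + 1) m, M.Encodes h := by
  refine ⟨⟨1, fun u => pathList r fun i => h i u, ?_, ?_, ?_, ?_⟩, hh, fun _ => rfl⟩
  · intro u
    refine isChain_pathList.2 fun i hi => ?_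
    have h1 := Finset.mem_Icc.1 (hh.mem i hi.le u)
    have h2 := Finset.mem_Icc.1 (hh.mem (i + 1) hi u)
    have h3 := hh.step i hi u
    refine ⟨?_, ?_, h1.1, h1.2, ?_, h3.imp id fun h => ⟨h, ?_⟩⟩
    · simp
    · simp only
      omega
    · simp
    · simp only
      omega
  · intro u
    rw [head?_pathList, Pvert, if_pos (by omega), hh.start]
  · intro u
    rw [getLast?_pathList, Qvert, if_neg (by omega), hh.finish]
    simp only [Equiv.Perm.one_apply, Option.some_inj, Prod.mk.injEq, true_and]
    omega
  · intro u u' hne v hv hv'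
    obtain ⟨i, hi, rfl⟩ := mem_pathList.1 hv
    obtain ⟨i', -, heq⟩ := mem_pathList.1 hv'
    obtain ⟨h1, h2⟩ := Prod.ext_iff.1 heq
    obtain rfl : i' = i := by simpa using h1
    exact hne ((hh.strictMono i' hi).injective h2.symm)

theorem Encodes.eqOn {M : GSys r s ((k : ℤ) + 1) ((r : ℤ) + 1) m} {h h' : ℕ → Fin m → ℤ}
    (hh : M.Encodes h) (hh' : M.Encodes h') : ∀ i ≤ r, h i = h' i := fun i hi =>
  funext fun u => eqOn_of_pathList_eq ((hh.path_eq u).symm.trans (hh'.path_eq u)) i hi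

theorem Encodes.eq_of_eqOn {M M' : GSys r s ((k : ℤ) + 1) ((r : ℤ) + 1) m}
    {h h' : ℕ → Fin m → ℤ} (hh : M.Encodes h) (hh' : M'.Encodes h')
    (heq : ∀ i ≤ r, h i = h' i) : M = M' :=
  ext_path <| funext fun u => by
    rw [hh.path_eq, hh'.path_eq]
    exact pathList_congr fun i hi => congrFun (heq i hi) u

end GSys

/-! ### The bijection -/

/-- In every row, the columns entered by the paths of `L` are complementary to the columns visited
by the paths of `M`. -/
def IsDual {r s k m : ℕ} (L : RSys 1 r 1 s k) (M : GSys r s ((k : ℤ) + 1) ((r : ℤ) + 1) m) :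
    Prop :=
  ∃ c h, L.Encodes c ∧ M.Encodes h ∧ ∀ i ≤ r, Complementary s (c i) (h i)

namespace IsDual

variable {r s k m : ℕ} {L L' : RSys 1 r 1 s k} {M M' : GSys r s ((k : ℤ) + 1) ((r : ℤ) + 1) m}

theorem exists_right (hs : k + m = s) (L : RSys 1 r 1 s k) :
    ∃ M : GSys r s ((k : ℤ) + 1) ((r : ℤ) + 1) m, IsDual L M := by
  obtain ⟨c, hc⟩ := L.exists_encodes
  obtain ⟨h, hcompl⟩ := hc.exists_complementary hs
  obtain ⟨M, hM⟩ := GSys.exists_of_isDiagFamily hs (hc.isDiagFamily hs hcompl)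
  exact ⟨M, c, h, hc, hM, hcompl⟩

theorem exists_left (hr : 1 ≤ r) (hs : k + m = s)
    (M : GSys r s ((k : ℤ) + 1) ((r : ℤ) + 1) m) : ∃ L : RSys 1 r 1 s k, IsDual L M := by
  obtain ⟨h, hh⟩ := M.exists_encodes hs
  obtain ⟨c, hcompl⟩ := hh.exists_complementary hs
  obtain ⟨L, hL⟩ := RSys.exists_of_isRowFamily hr (hh.isRowFamily hs hcompl)
  exact ⟨L, c, h, hL, hh, hcompl⟩

theorem right_unique (hs : k + m = s) (hM : IsDual L M) (hM' : IsDual L M') : M = M' := by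
  obtain ⟨c, h, hc, hh, hcompl⟩ := hM
  obtain ⟨c', h', hc', hh', hcompl'⟩ := hM'
  refine hh.eq_of_eqOn hh' fun i hi => (hcompl i hi).right_unique ?_ hs
  rw [hc.eqOn hc' i hi]
  exact hcompl' i hi

theorem left_unique (hs : k + m = s) (hL : IsDual L M) (hL' : IsDual L' M) : L = L' := by
  obtain ⟨c, h, hc, hh, hcompl⟩ := hL
  obtain ⟨c', h', hc', hh', hcompl'⟩ := hL'
  refine hc.eq_of_eqOn hc' fun i hi => (hcompl i hi).symm.right_unique ?_ (by omega)
  rw [hh.eqOn hh' i hi]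
  exact (hcompl' i hi).symm

theorem weight_eq (hs : k + m = s) (hLM : IsDual L M) {x : ℤ × ℤ → ℝ}
    (hx : ∀ p, inR r s p → x p ≠ 0) :
    GSysWeight x M = RSysWeight x L / wProd 1 r 1 s x := by
  obtain ⟨c, h, hc, hh, hcompl⟩ := hLM
  set R := Finset.Icc (1 : ℤ) r ×ˢ Finset.Icc (1 : ℤ) s with hR
  set V := Finset.univ.biUnion fun t => (L.path t).toFinset with hV
  have hVR : V ⊆ R := by
    intro v hv
    obtain ⟨t, -, ht⟩ := Finset.mem_biUnion.1 hv
    have := L.mem t v (List.mem_toFinset.1 ht)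
    simp only [hR, Finset.mem_product, Finset.mem_Icc]
    tauto
  have hLweight : RSysWeight x L = ∏ v ∈ V, x v := by
    rw [hV, Finset.prod_biUnion]
    · exact Finset.prod_congr rfl fun t _ =>
        (List.prod_toFinset x (nodup_of_isChain_coverStep (L.chain t))).symm
    · intro t _ t' _ hne
      rw [Function.onFun, Finset.disjoint_left]
      intro v hv hv'
      exact L.disjoint t t' hne v (List.mem_toFinset.1 hv) (List.mem_toFinset.1 hv')
  have hMweight : GSysWeight x M = ∏ v ∈ R \ V, (x v)⁻¹ := by
    have hsum : GSysWeight x M = ∏ p ∈ Finset.univ ×ˢ Finset.range r with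
        h (p.2 + 1) p.1 = h p.2 p.1, (x ((p.2 : ℤ) + 1, h p.2 p.1))⁻¹ := by
      rw [Finset.prod_filter, Finset.prod_product]
      exact Finset.prod_congr rfl fun u _ => by rw [hh.path_eq, listWt_pathList]
    have hvisited : ∀ i < r, ∀ j : ℤ, 1 ≤ j → j ≤ s →
        ((∃ u, h i u = j ∧ h (i + 1) u = j) ↔ ((i : ℤ) + 1, j) ∉ V) := by
      intro i hi j h1 hj
      rw [(hcompl i hi.le).exists_straight_iff (hcompl (i + 1) hi) hs (hc.step i hi) h1 hj,
        not_iff_not]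
      simp only [hV, Finset.mem_biUnion, Finset.mem_univ, true_and, List.mem_toFinset, hc.mem_iff]
      refine exists_congr fun t => ⟨fun ht => ⟨i, Nat.zero_le i, hi, rfl, ht⟩, ?_⟩
      rintro ⟨i', -, -, h2, h3⟩
      obtain rfl : i' = i := by simpa using h2.symm
      exact h3
    rw [hsum]
    refine Finset.prod_nbij (fun p => ((p.2 : ℤ) + 1, h p.2 p.1)) ?_ ?_ ?_ fun _ _ => rfl
    · rintro ⟨u, i⟩ hp
      simp only [Finset.mem_filter, Finset.mem_product, Finset.mem_univ, true_and,
        Finset.mem_range] at hp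
      obtain ⟨hi, heq⟩ := hp
      have hmem := hh.mem i hi.le u
      obtain ⟨h1, h2⟩ := Finset.mem_Icc.1 hmem
      rw [Finset.mem_sdiff, hR, Finset.mem_product]
      refine ⟨⟨Finset.mem_Icc.2 ⟨?_, ?_⟩, hmem⟩, (hvisited i hi _ h1 h2).1 ⟨u, rfl, heq⟩⟩
      · simp
      · simp only
        omega
    · rintro ⟨u, i⟩ hp ⟨u', i'⟩ hp' heq
      simp only [Finset.coe_filter, Finset.mem_product, Finset.mem_univ, true_and,
        Finset.mem_range, Set.mem_ofPred_eq] at hp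
      obtain ⟨h1, h2⟩ := Prod.ext_iff.1 heq
      obtain rfl : i = i' := by simpa using h1
      obtain rfl := (hh.strictMono i hp.1.le).injective h2
      rfl
    · rintro ⟨a, j⟩ hv
      rw [Finset.mem_coe, Finset.mem_sdiff, hR, Finset.mem_product, Finset.mem_Icc,
        Finset.mem_Icc] at hv
      obtain ⟨⟨⟨ha1, ha2⟩, hj1, hj2⟩, hnot⟩ := hv
      simp only at ha1 ha2 hj1 hj2
      obtain ⟨i, rfl⟩ : ∃ i : ℕ, a = (i : ℤ) + 1 := ⟨(a - 1).toNat, by omega⟩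
      obtain ⟨u, rfl, hu⟩ := (hvisited i (by omega) j hj1 hj2).2 hnot
      refine ⟨(u, i), ?_, rfl⟩
      simp only [Finset.coe_filter, Finset.mem_product, Finset.mem_univ, true_and,
        Finset.mem_range, Set.mem_ofPred_eq]
      exact ⟨by omega, hu⟩
  have hne : ∏ v ∈ R, x v ≠ 0 := Finset.prod_ne_zero_iff.2 fun v hv => hx v <| by
    simp only [hR, Finset.mem_product, Finset.mem_Icc] at hv
    exact ⟨hv.1.1, hv.1.2, hv.2.1, hv.2.2⟩
  have hsplit := Finset.prod_sdiff (f := x) hVR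
  rw [hMweight, hLweight, wProd, ← hR, eq_div_iff hne, ← hsplit, Finset.prod_inv_distrib,
    ← mul_assoc, inv_mul_cancel₀, one_mul]
  intro h0
  rw [h0, zero_mul] at hsplit
  exact hne hsplit.symm

end IsDual

/-- **Lemma 3.2.** There is a weight-dividing bijection from `𝒫_R^{(k)}` (collections of
`k` vertex-disjoint paths in `R = [r] × [s]` from `(1,1),…,(1,k)` to
`(r,s-k+1),…,(r,s)`) to the collections of `s-k` vertex-disjoint directed paths in
`𝒢_R` from `{P_{k+1},…,P_s}` to `{Q_{r+1},…,Q_{r+s-k}}`: the weight of `f(ℒ)` is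
`w(ℒ) / w_R(x)`. -/
theorem paths_bijection (r s : ℕ) (hr : 1 ≤ r) (hs : 1 ≤ s) (x : ℤ × ℤ → ℝ)
    (hx : ∀ p, inR r s p → 0 < x p) (k : ℕ) (hk : k ≤ s) :
    ∃ f : RSys 1 r 1 s k ≃ GSys r s ((k : ℤ) + 1) ((r : ℤ) + 1) (s - k),
      ∀ L : RSys 1 r 1 s k,
        GSysWeight x (f L) = RSysWeight x L / wProd 1 r 1 s x := by
  have hs' : k + (s - k) = s := by omega
  choose f hf using IsDual.exists_right (r := r) hs'
  refine ⟨Equiv.ofBijective f ⟨fun L L' hLL => ?_, fun M => ?_⟩, fun L =>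
    (hf L).weight_eq hs' fun p hp => (hx p hp).ne'⟩
  · have hL := hf L
    rw [hLL] at hL
    exact hL.left_unique hs' (hf L')
  · obtain ⟨L, hL⟩ := IsDual.exists_left hr hs' M
    exact ⟨L, (hf L).right_unique hs' hL⟩

end Paper
end
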